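/- Let N ≥ 1, κ > 0, ζ > 0, let m : ℝ → (Fin N → ℝ) be differentiable and β : ℝ → (Fin N → ℝ) with β_i(t) ≥ ζ for all i and t ≥ 0, with indices taken cyclically modulo N, and suppose m_i′(t) = κ [ β_{i+1}(t) (m_{i+1}(t) − m_i(t)) − β_i(t) (m_i(t) − m_{i−1}(t)) ] for all t ≥ 0. Then the Lyapunov function V(t) = (1/2) ∑_i (m_i(t) − m̄(t))², with m̄(t) = (1/N) ∑_j m_j(t), satisfies V(t) ≤ V(0) · exp(−8 κ ζ sin²(π/N) t) for all t ≥ 0. -/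

import Mathlib

open Finset Real

lemma aux_parseval (N : ℕ) [NeZero N] (x : ZMod N → ℝ) :
    ∑ k : ZMod N, ‖∑ j : ZMod N, ZMod.stdAddChar (k * j) * (x j : ℂ)‖ ^ 2
      = N * ∑ j : ZMod N, x j ^ 2 := by
  have hconj : ∀ a : ZMod N, (starRingEnd ℂ) (ZMod.stdAddChar a) = ZMod.stdAddChar (-a) := by
    intro a
    rw [AddChar.map_neg_eq_conj]
  have h : ((∑ k : ZMod N, ‖∑ j : ZMod N, ZMod.stdAddChar (k * j) * (x j : ℂ)‖ ^ 2 : ℝ) : ℂ)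
      = ((N * ∑ j : ZMod N, x j ^ 2 : ℝ) : ℂ) := by
    push_cast
    have h1 : ∀ k : ZMod N,
        ((‖∑ j : ZMod N, ZMod.stdAddChar (k * j) * (x j : ℂ)‖ : ℂ)) ^ 2
        = ∑ j : ZMod N, ∑ l : ZMod N,
          ZMod.stdAddChar (k * (j - l)) * ((x j : ℂ) * (x l : ℂ)) := by
      intro k
      rw [← Complex.mul_conj', map_sum, Finset.sum_mul_sum]
      refine Finset.sum_congr rfl fun j _ => Finset.sum_congr rfl fun l _ => ?_
      rw [map_mul (starRingEnd ℂ), hconj, Complex.conj_ofReal, mul_sub, sub_eq_add_neg, AddChar.map_add_eq_mul]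
      ring
    simp_rw [h1]
    rw [Finset.sum_comm, Finset.mul_sum]
    refine Finset.sum_congr rfl fun j _ => ?_
    rw [Finset.sum_comm]
    simp_rw [← Finset.sum_mul, AddChar.sum_mulShift _ (ZMod.isPrimitive_stdAddChar N), sub_eq_zero]
    simp [ZMod.card, pow_two]
  exact_mod_cast h

lemma aux_norm (N : ℕ) [NeZero N] (k : ZMod N) (hk : k ≠ 0) :
    4 * Real.sin (Real.pi / N) ^ 2 ≤ ‖(ZMod.stdAddChar (-k) : ℂ) - 1‖ ^ 2 := by
  have hN : (0 : ℝ) < N := by exact_mod_cast Nat.pos_of_ne_zero (NeZero.ne N)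
  set l := (-k).val with hl
  have hlN : l < N := ZMod.val_lt _
  have hl0 : 1 ≤ l := by
    rw [Nat.one_le_iff_ne_zero, hl, Ne, ZMod.val_eq_zero]
    simpa using hk
  have he : (ZMod.stdAddChar (-k) : ℂ) = Complex.exp (Complex.I * ((2 * π * l / N : ℝ) : ℂ)) := by
    have : (-k) = ((l : ℤ) : ZMod N) := by simp [hl]
    rw [this, ZMod.stdAddChar_coe]
    congr 1
    push_cast
    ring
  rw [he, Complex.norm_exp_I_mul_ofReal_sub_one, Real.norm_eq_abs, sq_abs]
  have h2 : 2 * π * l / N / 2 = π * l / N := by ring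
  rw [h2, mul_pow]
  have hpi := Real.pi_pos
  have hl0' : (1 : ℝ) ≤ l := by exact_mod_cast hl0
  have hlN' : (l : ℝ) + 1 ≤ N := by exact_mod_cast hlN
  have hs0 : 0 ≤ Real.sin (π / N) := by
    apply Real.sin_nonneg_of_nonneg_of_le_pi (by positivity)
    rw [div_le_iff₀ hN]; nlinarith
  have key : Real.sin (π / N) ≤ Real.sin (π * l / N) := by
    by_cases hc : (2 * l : ℝ) ≤ N
    · apply Real.sin_le_sin_of_le_of_le_pi_div_two
      · have : 0 ≤ π / N := by positivity
        linarith
      · rw [div_le_iff₀ hN]; nlinarith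
      · gcongr; nlinarith
    · push Not at hc
      rw [← Real.sin_pi_sub (π * l / N)]
      have e : π - π * l / N = π * (N - l) / N := by field_simp
      rw [e]
      apply Real.sin_le_sin_of_le_of_le_pi_div_two
      · have : 0 ≤ π / N := by positivity
        linarith
      · rw [div_le_iff₀ hN]; nlinarith
      · gcongr; nlinarith
  have := pow_le_pow_left₀ hs0 key 2
  linarith

lemma aux_wirtinger_zmod (N : ℕ) [NeZero N] (x : ZMod N → ℝ) (hx : ∑ j, x j = 0) :
    4 * Real.sin (Real.pi / N) ^ 2 * ∑ j, x j ^ 2 ≤ ∑ j, (x (j + 1) - x j) ^ 2 := by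
  have hN : (0 : ℝ) < N := by exact_mod_cast Nat.pos_of_ne_zero (NeZero.ne N)
  have p1 := aux_parseval N x
  have p2 := aux_parseval N (fun j => x (j + 1) - x j)
  refine le_of_mul_le_mul_left ?_ hN
  rw [← p2, mul_left_comm, ← p1, Finset.mul_sum]
  refine Finset.sum_le_sum fun k _ => ?_
  have hshift : ∑ j : ZMod N, ZMod.stdAddChar (k * j) * ((x (j + 1) - x j : ℝ) : ℂ)
      = (ZMod.stdAddChar (-k) - 1) * ∑ j : ZMod N, ZMod.stdAddChar (k * j) * (x j : ℂ) := by
    have h1 : ∑ j : ZMod N, ZMod.stdAddChar (k * j) * (x (j + 1) : ℂ)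
        = ZMod.stdAddChar (-k) * ∑ j : ZMod N, ZMod.stdAddChar (k * j) * (x j : ℂ) := by
      rw [← Equiv.sum_comp (Equiv.addRight (1 : ZMod N))
        (fun j => ZMod.stdAddChar (k * j) * (x j : ℂ)), Finset.mul_sum]
      refine Finset.sum_congr rfl fun j _ => ?_
      rw [Equiv.coe_addRight, ← mul_assoc, ← AddChar.map_add_eq_mul]
      congr 2
      ring
    rw [sub_mul, one_mul, ← h1, ← Finset.sum_sub_distrib]
    refine Finset.sum_congr rfl fun j _ => ?_
    push_cast; ring
  rw [hshift, norm_mul, mul_pow]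
  by_cases hk : k = 0
  · subst hk
    have : ∑ j : ZMod N, (x j : ℂ) = 0 := by exact_mod_cast hx
    simp [this]
  · exact mul_le_mul_of_nonneg_right (aux_norm N k hk) (by positivity)

lemma aux_wirtinger (N : ℕ) [NeZero N] (x : Fin N → ℝ) (hx : ∑ j, x j = 0) :
    4 * Real.sin (Real.pi / N) ^ 2 * ∑ j, x j ^ 2 ≤ ∑ j, (x j - x (j - 1)) ^ 2 := by
  have h : 4 * Real.sin (Real.pi / N) ^ 2 * ∑ j, x j ^ 2 ≤ ∑ j, (x (j + 1) - x j) ^ 2 := by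
    cases N with
    | zero => exact absurd rfl (NeZero.ne 0)
    | succ n => exact aux_wirtinger_zmod (n + 1) x hx
  refine h.trans (le_of_eq ?_)
  rw [← Equiv.sum_comp (Equiv.addRight (1 : Fin N)) (fun j => (x j - x (j - 1)) ^ 2)]
  simp

lemma aux_parts (N : ℕ) [NeZero N] (u a : Fin N → ℝ) :
    ∑ i, u i * (a (i + 1) - a i) = - ∑ i, a i * (u i - u (i - 1)) := by
  have h := Equiv.sum_comp (Equiv.addRight (1 : Fin N)) (fun j => u (j - 1) * a j)
  simp only [Equiv.coe_addRight, add_sub_cancel_right] at h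
  simp only [mul_sub, Finset.sum_sub_distrib, h]
  simp only [mul_comm]
  ring


/-- Exponential decay of the Lyapunov function (Lemma 3): under the workload
dynamics with boundary fluxes `β_i(t) ≥ ζ > 0` (indices cyclic modulo `N`),
`V(t) ≤ V(0) exp(−8 κ ζ sin²(π/N) t)` for all `t ≥ 0`, where
`V(t) = (1/2) ∑ i, (m_i(t) − m̄(t))²`. -/
theorem lyapunov_exponential_decay (N : ℕ) [NeZero N] (κ ζ : ℝ) (hκ : 0 < κ) (hζ : 0 < ζ)
    (m β : ℝ → Fin N → ℝ)
    (hdiff : ∀ i : Fin N, Differentiable ℝ (fun t => m t i))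
    (hβ : ∀ (i : Fin N) (t : ℝ), 0 ≤ t → ζ ≤ β t i)
    (hdyn : ∀ (i : Fin N) (t : ℝ), 0 ≤ t →
      deriv (fun τ => m τ i) t =
        κ * (β t (i + 1) * (m t (i + 1) - m t i) - β t i * (m t i - m t (i - 1)))) :
    ∀ t : ℝ, 0 ≤ t →
      (1 / 2) * ∑ i : Fin N, (m t i - (1 / (N : ℝ)) * ∑ j : Fin N, m t j) ^ 2 ≤
        ((1 / 2) * ∑ i : Fin N, (m 0 i - (1 / (N : ℝ)) * ∑ j : Fin N, m 0 j) ^ 2) *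
          Real.exp (-(8 * κ * ζ * Real.sin (Real.pi / N) ^ 2) * t) := by
  have hN : (0 : ℝ) < N := by exact_mod_cast Nat.pos_of_ne_zero (NeZero.ne N)
  set c : ℝ → ℝ := fun t => (1 / (N : ℝ)) * ∑ j : Fin N, m t j with hc
  set V : ℝ → ℝ := fun t => (1 / 2) * ∑ i : Fin N, (m t i - c t) ^ 2 with hV
  set K : ℝ := 8 * κ * ζ * Real.sin (Real.pi / N) ^ 2 with hK
  have hcd : ∀ t, HasDerivAt c ((1 / (N : ℝ)) * ∑ j : Fin N, deriv (fun τ => m τ j) t) t := by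
    intro t
    exact (HasDerivAt.fun_sum fun j _ => (hdiff j t).hasDerivAt).const_mul _
  have hVd : ∀ t, HasDerivAt V ((1 / 2) * ∑ i : Fin N, 2 * (m t i - c t) *
      (deriv (fun τ => m τ i) t - (1 / (N : ℝ)) * ∑ j : Fin N, deriv (fun τ => m τ j) t)) t := by
    intro t
    refine (HasDerivAt.fun_sum fun i _ => ?_).const_mul _
    have h := (((hdiff i t).hasDerivAt.fun_sub (hcd t)).fun_pow 2)
    refine h.congr_deriv ?_
    norm_num
  have hbound : ∀ t, 0 ≤ t → (1 / 2) * ∑ i : Fin N, 2 * (m t i - c t) *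
      (deriv (fun τ => m τ i) t - (1 / (N : ℝ)) * ∑ j : Fin N, deriv (fun τ => m τ j) t)
      ≤ -K * V t := by
    intro t ht
    have hsum0 : ∑ j : Fin N, deriv (fun τ => m τ j) t = 0 := by
      have h := aux_parts N (fun _ => κ) (fun i => β t i * (m t i - m t (i - 1)))
      simp only [add_sub_cancel_right, sub_self, mul_zero, Finset.sum_const_zero, neg_zero] at h
      rw [← h]
      exact Finset.sum_congr rfl fun j _ => hdyn j t ht
    have h := aux_parts N (fun i => m t i - c t) (fun i => β t i * (m t i - m t (i - 1)))
    simp only [add_sub_cancel_right, sub_sub_sub_cancel_right] at h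
    have hz : ∑ i : Fin N, (m t i - c t) = 0 := by
      simp [hc, Finset.sum_sub_distrib]
      field_simp
      ring
    have hw := aux_wirtinger N (fun i => m t i - c t) hz
    simp only [sub_sub_sub_cancel_right] at hw
    have hle : ζ * ∑ i : Fin N, (m t i - m t (i - 1)) ^ 2
        ≤ ∑ i : Fin N, β t i * (m t i - m t (i - 1)) * (m t i - m t (i - 1)) := by
      rw [Finset.mul_sum]
      refine Finset.sum_le_sum fun i _ => ?_
      have := mul_le_mul_of_nonneg_right (hβ i t ht) (sq_nonneg (m t i - m t (i - 1)))
      nlinarith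
    have hL : (1 / 2) * ∑ i : Fin N, 2 * (m t i - c t) *
      (deriv (fun τ => m τ i) t - (1 / (N : ℝ)) * ∑ j : Fin N, deriv (fun τ => m τ j) t)
      = κ * ∑ i : Fin N, (m t i - c t) * (β t (i + 1) * (m t (i + 1) - m t i)
          - β t i * (m t i - m t (i - 1))) := by
      rw [hsum0, Finset.mul_sum, Finset.mul_sum]
      refine Finset.sum_congr rfl fun i _ => ?_
      rw [hdyn i t ht]
      ring
    rw [hL, h]
    have h3 := (mul_le_mul_of_nonneg_left hw hζ.le).trans hle
    have h4 := mul_le_mul_of_nonneg_left h3 hκ.le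
    have h5 : K * V t = κ * (ζ * (4 * Real.sin (Real.pi / N) ^ 2
        * ∑ i : Fin N, (m t i - c t) ^ 2)) := by
      simp only [hK, hV]; ring
    linarith
  have hWd := fun t => (hVd t).mul (((hasDerivAt_id t).const_mul K).exp)
  have hanti : AntitoneOn (V * fun t => Real.exp (K * id t)) (Set.Ici 0) := by
    apply antitoneOn_of_deriv_nonpos (convex_Ici 0)
    · exact fun t _ => (hWd t).continuousAt.continuousWithinAt
    · exact fun t _ => (hWd t).differentiableAt.differentiableWithinAt
    · intro t ht
      rw [interior_Ici] at ht
      rw [(hWd t).deriv]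
      have := mul_le_mul_of_nonneg_right (hbound t (le_of_lt ht)) (Real.exp_pos (K * id t)).le
      linarith
  intro t ht
  have h := hanti (Set.mem_Ici.2 le_rfl) (Set.mem_Ici.2 ht) ht
  simp only [Pi.mul_apply, id, mul_zero, Real.exp_zero, mul_one] at h
  change V t ≤ V 0 * Real.exp (-K * t)
  rw [neg_mul, Real.exp_neg, ← div_eq_mul_inv, le_div_iff₀ (Real.exp_pos _)]
  exact h
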